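/- Let λ ∈ ℂ with Re λ ≥ 0 and suppose g : ℝ → ℂ is C^∞ on [0,1] and satisfies for all z ∈ (0,1) the Heun equation g''(z) + (7/(2z) + λ/(z−1) + 1/(2(z−2))) g'(z) + (1/4)((λ+4)(λ+2)z − (λ²+12λ+12))/(z(z−1)(z−2)) g(z) = 0. Then there exists a holomorphic function G on the open disc {w ∈ ℂ : |w| < 2} such that G(x) = g(x) for all x ∈ [0,1). -/

import Mathlib

open Set

/-- The Heun equation in standard form arising from the supersymmetric problem. -/
def HeunEq (l : ℂ) (g : ℝ → ℂ) (z : ℝ) : Prop :=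
  deriv (deriv g) z
    + (7 / (2 * (z : ℂ)) + l / ((z : ℂ) - 1) + 1 / (2 * ((z : ℂ) - 2))) * deriv g z
    + (1 / 4) * (((l + 4) * (l + 2) * (z : ℂ) - (l ^ 2 + 12 * l + 12)) /
        ((z : ℂ) * ((z : ℂ) - 1) * ((z : ℂ) - 2))) * g z = 0

open Filter Topology

section Sequences

/-- Increments governed by a perturbed contraction are summable. -/
theorem summable_norm_increment {q : ℕ → ℂ} {β : ℝ} {ε : ℕ → ℝ} (hβ : β < 1)
    (hε0 : ∀ n, 0 ≤ ε n) (hε : Summable ε)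
    (h : ∀ n, ‖q (n + 2) - q (n + 1)‖ ≤ β * ‖q (n + 1) - q n‖ + ε n * ‖q (n + 1)‖) :
    Summable fun n ↦ ‖q (n + 1) - q n‖ := by
  set d : ℕ → ℝ := fun n ↦ ‖q (n + 1) - q n‖ with hd
  have hd0 : ∀ n, 0 ≤ d n := fun n ↦ norm_nonneg _
  obtain ⟨c, hc⟩ : ∃ c : ℝ, c * (1 - β) = 1 := ⟨(1 - β)⁻¹, inv_mul_cancel₀ (by linarith)⟩
  have hc0 : 0 < c := by
    by_contra! hneg
    nlinarith
  have hstep : ∀ n, ‖q (n + 2)‖ + c * d (n + 1)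
      ≤ Real.exp ((1 + c) * ε n) * (‖q (n + 1)‖ + c * d n) := by
    intro n
    have h1 : ‖q (n + 2)‖ ≤ ‖q (n + 1)‖ + d (n + 1) := by
      have := norm_add_le (q (n + 1)) (q (n + 2) - q (n + 1))
      simpa [hd] using this
    have h2 : d (n + 1) ≤ β * d n + ε n * ‖q (n + 1)‖ := h n
    have h3 := Real.add_one_le_exp ((1 + c) * ε n)
    have h4 : 0 ≤ ‖q (n + 1)‖ + c * d n := by have := hd0 n; positivity
    calc ‖q (n + 2)‖ + c * d (n + 1) ≤ ‖q (n + 1)‖ + (1 + c) * d (n + 1) := by linarith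
      _ ≤ ‖q (n + 1)‖ + (1 + c) * (β * d n + ε n * ‖q (n + 1)‖) := by gcongr
      _ ≤ ((1 + c) * ε n + 1) * (‖q (n + 1)‖ + c * d n) := by
          have e1 : (1 + c) * β ≤ c := by linarith
          have e2 : 0 ≤ (1 + c) * ε n * (c * d n) := by
            have := hd0 n; have := hε0 n; positivity
          have e3 := mul_le_mul_of_nonneg_right e1 (hd0 n)
          have e4 : 0 ≤ (1 + c) * ε n := by have := hε0 n; positivity
          nlinarith
      _ ≤ _ := by gcongr
  have hbd : ∀ n, ‖q (n + 1)‖ + c * d n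
      ≤ Real.exp ((1 + c) * ∑ i ∈ Finset.range n, ε i) * (‖q 1‖ + c * d 0) := by
    intro n
    induction n with
    | zero => simp
    | succ n ih =>
      refine (hstep n).trans ?_
      rw [Finset.sum_range_succ, mul_add (1 + c), Real.exp_add,
        mul_comm (Real.exp _) (Real.exp _), mul_assoc]
      gcongr
  set M := Real.exp ((1 + c) * ∑' i, ε i) * (‖q 1‖ + c * d 0) with hM
  have hq : ∀ n, ‖q (n + 1)‖ ≤ M := by
    intro n
    have h1 : ∑ i ∈ Finset.range n, ε i ≤ ∑' i, ε i := hε.sum_le_tsum _ (fun i _ ↦ hε0 i)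
    have h2 : Real.exp ((1 + c) * ∑ i ∈ Finset.range n, ε i) * (‖q 1‖ + c * d 0) ≤ M := by
      have := hd0 0
      rw [hM]; gcongr
    have := hd0 n
    have : 0 ≤ c * d n := by positivity
    linarith [hbd n]
  have hM0 : 0 ≤ M := (norm_nonneg _).trans (hq 0)
  refine summable_of_sum_range_le (c := c * (d 0 + M * ∑' i, ε i)) hd0 fun n ↦ ?_
  have hrec : ∑ i ∈ Finset.range n, d (i + 1)
      ≤ β * ∑ i ∈ Finset.range n, d i + M * ∑' i, ε i := by
    calc ∑ i ∈ Finset.range n, d (i + 1) ≤ ∑ i ∈ Finset.range n, (β * d i + M * ε i) := by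
          refine Finset.sum_le_sum fun i _ ↦ (h i).trans ?_
          have := mul_le_mul_of_nonneg_left (hq i) (hε0 i)
          simp only [hd]; linarith
      _ = β * ∑ i ∈ Finset.range n, d i + M * ∑ i ∈ Finset.range n, ε i := by
          rw [Finset.sum_add_distrib, Finset.mul_sum, Finset.mul_sum]
      _ ≤ _ := by
          gcongr
          exact hε.sum_le_tsum _ (fun i _ ↦ hε0 i)
  have h1 := Finset.sum_range_succ' d n
  have h2 := Finset.sum_range_succ d n
  have h3 := hd0 n
  have key : (1 - β) * ∑ i ∈ Finset.range n, d i ≤ d 0 + M * ∑' i, ε i := by linarith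
  calc ∑ i ∈ Finset.range n, d i = c * ((1 - β) * ∑ i ∈ Finset.range n, d i) := by
        rw [← mul_assoc, hc, one_mul]
    _ ≤ _ := by gcongr

/-- A null sequence whose increments obey a perturbed contraction decays geometrically. -/
theorem norm_le_geometric_of_tendsto_zero {q : ℕ → ℂ} {β ρ : ℝ} {ε : ℕ → ℝ} (hβ0 : 0 ≤ β)
    (hε0 : ∀ n, 0 ≤ ε n) (hε : Summable ε)
    (hT : ∑' n, ε n < 1) (hρ : β ≤ (1 - ∑' n, ε n) * ρ)
    (h : ∀ n, ‖q (n + 2) - q (n + 1)‖ ≤ β * ‖q (n + 1) - q n‖ + ε n * ‖q (n + 1)‖)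
    (hs : Summable fun n ↦ ‖q (n + 1) - q n‖) (hq : Tendsto q atTop (𝓝 0)) :
    ∃ C, ∀ n, ‖q n‖ ≤ C * ρ ^ n := by
  set d : ℕ → ℝ := fun n ↦ ‖q (n + 1) - q n‖ with hd
  set S : ℕ → ℝ := fun n ↦ ∑' m, d (m + n) with hS
  have hsn : ∀ n, Summable fun m ↦ d (m + n) := fun n ↦ (summable_nat_add_iff n).2 hs
  have hS0 : ∀ n, 0 ≤ S n := fun n ↦ tsum_nonneg fun m ↦ norm_nonneg _
  have hqS : ∀ n, ‖q n‖ ≤ S n := by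
    intro n
    have := dist_le_tsum_of_dist_le_of_tendsto (f := q) d (fun n ↦ by
      rw [dist_comm, dist_eq_norm]) hs hq n
    simpa [dist_zero_right, hS, add_comm] using this
  have hmono : ∀ n m, S (n + m) ≤ S n := by
    intro n m
    have h1 := (hsn n).sum_add_tsum_nat_add m
    have h2 : 0 ≤ ∑ i ∈ Finset.range m, d (i + n) := Finset.sum_nonneg fun i _ ↦ norm_nonneg _
    have h3 : S (n + m) = ∑' i, d (i + m + n) := by
      simp only [hS]; congr 1; ext i; congr 1; ring
    rw [h3]; simp only [hS]; linarith
  have hstep : ∀ n, S (n + 1) ≤ ρ * S n := by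
    intro n
    have hεn : Summable fun m ↦ ε (m + n) := (summable_nat_add_iff n).2 hε
    have hεT : ∑' m, ε (m + n) ≤ ∑' m, ε m := by
      have := hε.sum_add_tsum_nat_add n
      have h2 : 0 ≤ ∑ i ∈ Finset.range n, ε i := Finset.sum_nonneg fun i _ ↦ hε0 i
      linarith
    have h1 : S (n + 1) ≤ β * S n + (∑' m, ε (m + n)) * S (n + 1) := by
      simp only [hS]
      rw [← tsum_mul_left, ← tsum_mul_right, ← ((hsn n).mul_left β).tsum_add (hεn.mul_right _)]
      refine (hsn (n + 1)).tsum_le_tsum (fun m ↦ ?_) (((hsn n).mul_left β).add (hεn.mul_right _))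
      have h2 := h (m + n)
      have h3 : ‖q (m + n + 1)‖ ≤ S (n + 1) := by
        have := hmono (n + 1) m
        rw [show n + 1 + m = m + n + 1 by ring] at this
        exact (hqS _).trans this
      have h4 := mul_le_mul_of_nonneg_left h3 (hε0 (m + n))
      have : d (m + (n + 1)) = ‖q (m + n + 2) - q (m + n + 1)‖ := rfl
      rw [this]
      simp only [hd, hS] at h4 ⊢
      linarith
    have h5 := mul_le_mul_of_nonneg_right hεT (hS0 (n + 1))
    have h6 := mul_le_mul_of_nonneg_right hρ (hS0 n)
    have h7 : (1 - ∑' m, ε m) * S (n + 1) ≤ (1 - ∑' m, ε m) * (ρ * S n) := by linarith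
    exact le_of_mul_le_mul_left h7 (by linarith)
  have hρ0 : 0 ≤ ρ := by
    by_contra! hneg
    nlinarith
  refine ⟨S 0, fun n ↦ (hqS n).trans ?_⟩
  induction n with
  | zero => simp
  | succ n ih =>
    refine (hstep n).trans ?_
    calc ρ * S n ≤ ρ * (S 0 * ρ ^ n) := by gcongr
      _ = _ := by ring

end Sequences

section NegBinomial

/-- The Taylor coefficients of `(1 - z) ^ (-s)` at `0`. -/
noncomputable def negBinomCoeff (s : ℂ) (n : ℕ) : ℂ :=
  ∏ j ∈ Finset.range n, ((s + j) / (j + 1))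

theorem negBinomCoeff_eq_choose (s : ℂ) (n : ℕ) :
    negBinomCoeff s n = Ring.choose (s + n - 1) n := by
  have h := Ring.factorial_nsmul_multichoose_eq_ascPochhammer s n
  rw [Ring.multichoose_eq, Polynomial.ascPochhammer_smeval_eq_eval, nsmul_eq_mul] at h
  have hn : ((n.factorial : ℕ) : ℂ) ≠ 0 := by exact_mod_cast n.factorial_ne_zero
  have h2 : (n.factorial : ℂ) * negBinomCoeff s n = (ascPochhammer ℂ n).eval s := by
    clear h hn
    induction n with
    | zero => simp [negBinomCoeff]
    | succ n ih =>
      rw [ascPochhammer_succ_eval, ← ih, negBinomCoeff, Finset.prod_range_succ, ← negBinomCoeff,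
        Nat.factorial_succ]
      have : (n : ℂ) + 1 ≠ 0 := by exact_mod_cast n.succ_ne_zero
      push_cast
      field_simp
  exact mul_left_cancel₀ hn (h2.trans h.symm)

theorem hasSum_negBinomCoeff (s : ℂ) {z : ℂ} (hz : ‖z‖ < 1) :
    HasSum (fun n ↦ negBinomCoeff s n * z ^ n) (1 / (1 - z) ^ s) := by
  have h := (Complex.one_div_one_sub_cpow_hasFPowerSeriesOnBall_zero s).hasSum (y := z)
    (by simpa [enorm_eq_nnnorm, ← NNReal.coe_lt_coe] using hz)
  simpa [FormalMultilinearSeries.ofScalars, negBinomCoeff_eq_choose, mul_comm] using h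

theorem negBinomCoeff_ne_zero {s : ℂ} (hs : 0 < s.re) (n : ℕ) : negBinomCoeff s n ≠ 0 := by
  refine Finset.prod_ne_zero_iff.2 fun j _ ↦ div_ne_zero (fun h ↦ ?_) (by exact_mod_cast j.succ_ne_zero)
  have := congrArg Complex.re h
  simp at this
  have : (0 : ℝ) ≤ j := j.cast_nonneg
  linarith

theorem norm_negBinomCoeff_ofReal {σ : ℝ} (hσ : 0 < σ) (n : ℕ) :
    (‖negBinomCoeff σ n‖ : ℂ) = negBinomCoeff σ n := by
  rw [negBinomCoeff, norm_prod, Complex.ofReal_prod]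
  refine Finset.prod_congr rfl fun j _ ↦ ?_
  have h : ((σ : ℂ) + j) / (j + 1) = (((σ + j) / (j + 1) : ℝ) : ℂ) := by push_cast; rfl
  rw [h, Complex.norm_real, Real.norm_of_nonneg (by positivity)]

theorem hasSum_norm_negBinomCoeff {σ : ℝ} (hσ : 0 < σ) {x : ℝ} (hx0 : 0 ≤ x) (hx : x < 1) :
    HasSum (fun n ↦ ‖negBinomCoeff σ n‖ * x ^ n) ((1 - x) ^ (-σ)) := by
  have h := hasSum_negBinomCoeff σ (z := x) (by simpa [abs_of_nonneg hx0] using hx)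
  rw [← Complex.hasSum_ofReal]
  convert h using 1
  · ext n
    push_cast
    rw [norm_negBinomCoeff_ofReal hσ]
  · rw [Complex.ofReal_cpow (by linarith)]
    push_cast
    rw [Complex.cpow_neg, one_div]

theorem norm_negBinomCoeff_succ {s : ℂ} (hs : 0 < s.re) {n : ℕ} (hn : n ≠ 0) :
    ‖negBinomCoeff s (n + 1)‖ * ‖Complex.GammaSeq s n‖ = (n : ℝ) ^ s.re / (n + 1) := by
  have h0 := negBinomCoeff_ne_zero hs (n + 1)
  have h1 : negBinomCoeff s (n + 1)
      = (∏ j ∈ Finset.range (n + 1), (s + j)) / ((n + 1).factorial : ℂ) := by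
    rw [negBinomCoeff, Finset.prod_div_distrib, ← Finset.prod_range_add_one_eq_factorial]
    push_cast
    rfl
  have h2 : (∏ j ∈ Finset.range (n + 1), (s + j)) ≠ 0 := by
    intro h; rw [h1, h, zero_div] at h0; exact h0 rfl
  have h3 : ((n.factorial : ℕ) : ℂ) ≠ 0 := by exact_mod_cast n.factorial_ne_zero
  have h4 : (n : ℂ) + 1 ≠ 0 := by exact_mod_cast n.succ_ne_zero
  rw [← norm_mul, Complex.GammaSeq, h1, Nat.factorial_succ]
  have h5 : (∏ j ∈ Finset.range (n + 1), (s + j)) / (((n + 1) * n.factorial : ℕ) : ℂ)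
      * ((n : ℂ) ^ s * n.factorial / ∏ j ∈ Finset.range (n + 1), (s + j))
      = (n : ℂ) ^ s / ((n + 1 : ℝ) : ℂ) := by
    push_cast
    field_simp
  rw [h5, norm_div, Complex.norm_real, Complex.norm_natCast_cpow_of_pos (Nat.pos_of_ne_zero hn),
    Real.norm_of_nonneg (by positivity)]

theorem exists_norm_negBinomCoeff_le {s : ℂ} (hs : 0 < s.re) :
    ∃ K, 0 ≤ K ∧ ∀ n, ‖negBinomCoeff s n‖ ≤ K * ‖negBinomCoeff (s.re : ℂ) n‖ := by
  have hσ : 0 < ((s.re : ℂ)).re := by simpa using hs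
  have hlim : Tendsto (fun n ↦ ‖Complex.GammaSeq s.re n‖ / ‖Complex.GammaSeq s n‖) atTop
      (𝓝 (‖Complex.Gamma s.re‖ / ‖Complex.Gamma s‖)) :=
    (Complex.GammaSeq_tendsto_Gamma _).norm.div (Complex.GammaSeq_tendsto_Gamma _).norm
      (norm_ne_zero_iff.2 (Complex.Gamma_ne_zero_of_re_pos hs))
  have hlim' : Tendsto (fun n ↦ ‖negBinomCoeff s (n + 1)‖ / ‖negBinomCoeff (s.re : ℂ) (n + 1)‖)
      atTop (𝓝 (‖Complex.Gamma s.re‖ / ‖Complex.Gamma s‖)) := by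
    refine hlim.congr' ?_
    filter_upwards [eventually_ne_atTop 0] with n hn
    have h1 := norm_negBinomCoeff_succ hs hn
    have h2 := norm_negBinomCoeff_succ hσ hn
    have hp : 0 < (n : ℝ) ^ s.re / (n + 1) := by
      have : (0 : ℝ) < n := by exact_mod_cast Nat.pos_of_ne_zero hn
      positivity
    have h3 : ‖Complex.GammaSeq s n‖ ≠ 0 := fun h ↦ by rw [h, mul_zero] at h1; linarith
    have h4 : ‖negBinomCoeff (s.re : ℂ) (n + 1)‖ ≠ 0 :=
      norm_ne_zero_iff.2 (negBinomCoeff_ne_zero hσ _)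
    rw [div_eq_div_iff h3 h4, h1, mul_comm, h2, Complex.ofReal_re]
  have hlim'' := (tendsto_add_atTop_iff_nat
    (f := fun n ↦ ‖negBinomCoeff s n‖ / ‖negBinomCoeff (s.re : ℂ) n‖) 1).1 hlim'
  obtain ⟨K, hK⟩ := hlim''.bddAbove_range
  have hK' : ∀ n, ‖negBinomCoeff s n‖ / ‖negBinomCoeff (s.re : ℂ) n‖ ≤ K :=
    fun n ↦ hK ⟨n, rfl⟩
  refine ⟨K, le_trans (by positivity) (hK' 0), fun n ↦ ?_⟩
  exact (div_le_iff₀ (norm_pos_iff.2 (negBinomCoeff_ne_zero hσ n))).1 (hK' n)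

/-- A power series whose coefficients are asymptotic to a nonzero multiple of those of
`(1 - z) ^ (-s)`, with `0 < re s`, is unbounded near `1`. -/
theorem eq_zero_of_bounded_of_tendsto {s : ℂ} (hs : 0 < s.re) {q : ℕ → ℂ} {c : ℂ}
    (hq : Tendsto q atTop (𝓝 c)) {M : ℝ}
    (hM : ∀ x ∈ Ioo (0 : ℝ) 1, ‖∑' n, q n * negBinomCoeff s n * (x : ℂ) ^ n‖ ≤ M) : c = 0 := by
  by_contra hc
  obtain ⟨K, hK0, hK⟩ := exists_norm_negBinomCoeff_le hs
  have hc' : 0 < ‖c‖ := norm_pos_iff.2 hc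
  set ε := ‖c‖ / (2 * (K + 1)) with hε
  have hε0 : 0 < ε := by positivity
  have hεK : ε * K ≤ ‖c‖ / 2 := by
    rw [hε, div_mul_eq_mul_div, div_le_div_iff₀ (by positivity) (by norm_num)]
    nlinarith
  obtain ⟨N, hN⟩ := Metric.tendsto_atTop.1 hq ε hε0
  set D := ∑ n ∈ Finset.range N, ‖q n - c‖ * ‖negBinomCoeff s n‖ with hD
  have key : ∀ x ∈ Ioo (0 : ℝ) 1, ‖c‖ / 2 * (1 - x) ^ (-s.re) ≤ M + D := by
    intro x hx
    have hxn : ‖(x : ℂ)‖ = x := by simp [abs_of_pos hx.1]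
    have hβ := hasSum_norm_negBinomCoeff hs hx.1.le hx.2
    have hb := (hasSum_negBinomCoeff s (z := x) (by rw [hxn]; exact hx.2)).mul_left c
    set e : ℕ → ℝ := fun n ↦ if n ∈ Finset.range N then ‖q n - c‖ * ‖negBinomCoeff s n‖ else 0
    have he : HasSum e D := by
      have h0 := hasSum_sum_of_ne_finset_zero (f := e) (s := Finset.range N)
        (L := SummationFilter.unconditional ℕ) (fun n hn ↦ by simp only [e, if_neg hn])
      have : ∑ n ∈ Finset.range N, e n = D := Finset.sum_congr rfl fun n hn ↦ by
        simp only [e, if_pos hn]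
      rwa [this] at h0
    have hdom := he.add (hβ.mul_left (ε * K))
    have hle : ∀ n, ‖(q n - c) * negBinomCoeff s n * (x : ℂ) ^ n‖
        ≤ e n + ε * K * (‖negBinomCoeff (s.re : ℂ) n‖ * x ^ n) := by
      intro n
      rw [norm_mul, norm_mul, norm_pow, hxn]
      have hxp : 0 ≤ x ^ n := pow_nonneg hx.1.le n
      by_cases hn : n ∈ Finset.range N
      · have hx1 : x ^ n ≤ 1 := pow_le_one₀ hx.1.le hx.2.le
        have : ‖q n - c‖ * ‖negBinomCoeff s n‖ * x ^ n ≤ ‖q n - c‖ * ‖negBinomCoeff s n‖ :=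
          mul_le_of_le_one_right (by positivity) hx1
        have h0 : 0 ≤ ε * K * (‖negBinomCoeff (s.re : ℂ) n‖ * x ^ n) := by positivity
        simp only [e, if_pos hn]
        linarith
      · have h1 := (hN n (by simpa using hn)).le
        rw [dist_eq_norm] at h1
        simp only [e, if_neg hn, zero_add]
        calc ‖q n - c‖ * ‖negBinomCoeff s n‖ * x ^ n
            ≤ ε * (K * ‖negBinomCoeff (s.re : ℂ) n‖) * x ^ n := by gcongr; exact hK n
          _ = _ := by ring
    have hsum : Summable fun n ↦ (q n - c) * negBinomCoeff s n * (x : ℂ) ^ n :=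
      Summable.of_norm_bounded hdom.summable hle
    have h1 : ‖∑' n, (q n - c) * negBinomCoeff s n * (x : ℂ) ^ n‖
        ≤ D + ε * K * (1 - x) ^ (-s.re) := tsum_of_norm_bounded hdom hle
    have h2 : ∑' n, q n * negBinomCoeff s n * (x : ℂ) ^ n
        = ∑' n, (q n - c) * negBinomCoeff s n * (x : ℂ) ^ n + c * (1 / (1 - x) ^ s) := by
      rw [← hb.tsum_eq, ← hsum.tsum_add hb.summable]
      congr 1; ext n; ring
    have h3 : ‖c * (1 / (1 - (x : ℂ)) ^ s)‖ = ‖c‖ * (1 - x) ^ (-s.re) := by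
      have : (1 - (x : ℂ)) = ((1 - x : ℝ) : ℂ) := by push_cast; rfl
      rw [norm_mul, norm_div, norm_one, this,
        Complex.norm_cpow_eq_rpow_re_of_pos (by linarith [hx.2]),
        Real.rpow_neg (by linarith [hx.2]), one_div]
    have h4 := hM x hx
    have h5 : ‖c * (1 / (1 - (x : ℂ)) ^ s)‖ ≤ M + (D + ε * K * (1 - x) ^ (-s.re)) := by
      have : c * (1 / (1 - (x : ℂ)) ^ s) = ∑' n, q n * negBinomCoeff s n * (x : ℂ) ^ n
        - ∑' n, (q n - c) * negBinomCoeff s n * (x : ℂ) ^ n := by rw [h2]; ring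
      rw [this]
      exact (norm_sub_le _ _).trans (add_le_add h4 h1)
    rw [h3] at h5
    have h6 : 0 < (1 - x) ^ (-s.re) := Real.rpow_pos_of_pos (by linarith [hx.2]) _
    have h7 := mul_le_mul_of_nonneg_right hεK h6.le
    linarith
  have htop : Tendsto (fun t : ℝ ↦ ‖c‖ / 2 * t ^ (-s.re)) (𝓝[>] 0) atTop :=
    (tendsto_rpow_neg_nhdsGT_zero (by linarith)).const_mul_atTop (by positivity)
  obtain ⟨t, ht, ht'⟩ := ((htop.eventually_gt_atTop (M + D)).and
    (Ioo_mem_nhdsGT (show (0 : ℝ) < 1 by norm_num))).exists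
  have := key (1 - t) ⟨by linarith [ht'.2], by linarith [ht'.1]⟩
  rw [sub_sub_cancel] at this
  linarith

end NegBinomial

section PowerSeries

theorem summable_deriv_coeff {a : ℕ → ℂ} {R : ℝ}
    (h : ∀ r, 0 ≤ r → r < R → Summable fun n ↦ ‖a n‖ * r ^ n) (r : ℝ) (hr0 : 0 ≤ r) (hr : r < R) :
    Summable fun n : ℕ ↦ ‖((n : ℂ) + 1) * a (n + 1)‖ * r ^ n := by
  obtain ⟨t, hrt, htR⟩ := exists_between hr
  have ht : 0 < t := hr0.trans_lt hrt
  have hlim := (tendsto_self_mul_const_pow_of_lt_one (div_nonneg hr0 ht.le)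
    ((div_lt_one ht).2 hrt)).add
    (tendsto_pow_atTop_nhds_zero_of_lt_one (div_nonneg hr0 ht.le) ((div_lt_one ht).2 hrt))
  obtain ⟨B, hB⟩ := hlim.bddAbove_range
  have hs := ((summable_nat_add_iff 1).2 (h t ht.le htR)).mul_left (B / t)
  refine Summable.of_nonneg_of_le (fun n ↦ by positivity) (fun n ↦ ?_) hs
  have hBn : (n : ℝ) * (r / t) ^ n + (r / t) ^ n ≤ B := hB ⟨n, rfl⟩
  have hn : ‖(n : ℂ) + 1‖ = n + 1 := by
    rw [show (n : ℂ) + 1 = ((n + 1 : ℝ) : ℂ) by push_cast; rfl, Complex.norm_real,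
      Real.norm_of_nonneg (by positivity)]
  rw [norm_mul, hn]
  calc (n + 1 : ℝ) * ‖a (n + 1)‖ * r ^ n
      = (n * (r / t) ^ n + (r / t) ^ n) / t * (‖a (n + 1)‖ * t ^ (n + 1)) := by
        rw [div_pow]; field_simp; ring
    _ ≤ B / t * (‖a (n + 1)‖ * t ^ (n + 1)) := by gcongr

theorem summable_mul_pow {a : ℕ → ℂ} {R : ℝ}
    (h : ∀ r, 0 ≤ r → r < R → Summable fun n ↦ ‖a n‖ * r ^ n) {z : ℂ} (hz : ‖z‖ < R) :
    Summable fun n ↦ a n * z ^ n := by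
  refine Summable.of_norm ?_
  simpa using h ‖z‖ (norm_nonneg z) hz

theorem hasDerivAt_tsum_pow {a : ℕ → ℂ} {R : ℝ}
    (h : ∀ r, 0 ≤ r → r < R → Summable fun n ↦ ‖a n‖ * r ^ n) {z : ℂ} (hz : ‖z‖ < R) :
    HasDerivAt (fun z ↦ ∑' n, a n * z ^ n) (∑' n : ℕ, ((n : ℂ) + 1) * a (n + 1) * z ^ n) z := by
  obtain ⟨r, hzr, hrR⟩ := exists_between hz
  have hr : 0 < r := (norm_nonneg z).trans_lt hzr
  have hu : Summable fun n : ℕ ↦ ‖a n * n‖ * r ^ (n - 1) := by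
    rw [← summable_nat_add_iff 1]
    refine (summable_deriv_coeff h r hr.le hrR).congr fun n ↦ ?_
    simp [mul_comm]
  have hb : ∀ n : ℕ, ∀ y ∈ Metric.ball (0 : ℂ) r,
      ‖a n * (n * y ^ (n - 1))‖ ≤ ‖a n * n‖ * r ^ (n - 1) := by
    intro n y hy
    rw [← mul_assoc, norm_mul (a n * n), norm_pow]
    have : ‖y‖ ≤ r := by simpa using (mem_ball_zero_iff.1 hy).le
    gcongr
  have key := hasDerivAt_tsum_of_isPreconnected (g := fun n z ↦ a n * z ^ n)
    (g' := fun n z ↦ a n * (n * z ^ (n - 1))) hu Metric.isOpen_ball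
    (convex_ball (0 : ℂ) r).isPreconnected (fun n y _ ↦ (hasDerivAt_pow n y).const_mul (a n)) hb
    (Metric.mem_ball_self hr) (summable_mul_pow h (by simpa using hr.trans hrR))
    (y := z) (by simpa using hzr)
  have hs : Summable fun n : ℕ ↦ a n * (n * z ^ (n - 1)) :=
    Summable.of_norm_bounded hu fun n ↦ hb n z (by simpa using hzr)
  have heq : ∑' n : ℕ, ((n : ℂ) + 1) * a (n + 1) * z ^ n
      = ∑' n : ℕ, a n * (n * z ^ (n - 1)) := by
    rw [hs.tsum_eq_zero_add]
    simp only [Nat.cast_zero, zero_mul, mul_zero, zero_add, Nat.add_sub_cancel]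
    congr 1; ext n; push_cast; ring
  rw [heq]
  exact key

end PowerSeries

section Uniqueness

/-- A solution of `z w₂ + (7/2) w₁ = z P w₁ + Q w`, where `w₁` and `w₂` are the first two
derivatives of `w`, that has bounded derivative near the singular point `0` and vanishes there is
identically zero. -/
theorem eq_zero_of_singular_ode {w w₁ w₂ P Q : ℝ → ℂ} {b K M : ℝ}
    (hw : ∀ z ∈ Ioo 0 b, HasDerivAt w (w₁ z) z) (hw₁ : ∀ z ∈ Ioo 0 b, HasDerivAt w₁ (w₂ z) z)
    (hode : ∀ z ∈ Ioo 0 b, z * w₂ z + 7 / 2 * w₁ z = z * P z * w₁ z + Q z * w z)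
    (hP : ∀ z ∈ Ioo 0 b, ‖P z‖ ≤ K) (hQ : ∀ z ∈ Ioo 0 b, ‖Q z‖ ≤ K)
    (hM : ∀ z ∈ Ioo 0 b, ‖w₁ z‖ ≤ M) (h0 : Tendsto w (𝓝[>] 0) (𝓝 0)) :
    ∀ z ∈ Ioo 0 b, w z = 0 := by
  intro z₀ hz₀
  have hb : 0 < b := hz₀.1.trans hz₀.2
  have hK : 0 ≤ K := (norm_nonneg _).trans (hP z₀ hz₀)
  have hwM : ∀ z ∈ Ioo 0 b, ‖w z‖ ≤ M * z := by
    intro z hz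
    have hlim : Tendsto (fun y ↦ ‖w z - w y‖) (𝓝[>] 0) (𝓝 ‖w z - 0‖) :=
      (tendsto_const_nhds.sub h0).norm
    rw [sub_zero] at hlim
    refine le_of_tendsto hlim ?_
    filter_upwards [Ioo_mem_nhdsGT hz.1] with y hy
    have hM0 : 0 ≤ M := (norm_nonneg _).trans (hM z hz)
    have := (convex_Ioo 0 b).norm_image_sub_le_of_norm_hasDerivWithin_le (f := w) (f' := w₁)
      (fun x hx ↦ (hw x hx).hasDerivWithinAt) hM ⟨hy.1, hy.2.trans hz.2⟩ hz
    refine this.trans ?_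
    rw [Real.norm_of_nonneg (by linarith [hy.2])]
    have := hy.1
    gcongr
    linarith
  set E : ℝ → ℝ := fun z ↦ ‖w z‖ ^ 2 / z + z * ‖w₁ z‖ ^ 2 with hE
  set E' : ℝ → ℝ := fun z ↦ (2 * inner ℝ (w z) (w₁ z) * z - ‖w z‖ ^ 2 * 1) / z ^ 2
    + (1 * ‖w₁ z‖ ^ 2 + z * (2 * inner ℝ (w₁ z) (w₂ z))) with hE'
  have hEd : ∀ z ∈ Ioo 0 b, HasDerivAt E (E' z) z := fun z hz ↦
    (((hw z hz).norm_sq.div (hasDerivAt_id z) hz.1.ne').add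
      ((hasDerivAt_id z).mul (hw₁ z hz).norm_sq))
  have hE'le : ∀ z ∈ Ioo 0 b, E' z ≤ 3 * K * E z := by
    intro z hz
    have hz0 := hz.1
    obtain ⟨A, hA⟩ : ∃ A, ‖w z‖ = A * z := ⟨‖w z‖ / z, by field_simp⟩
    set B := ‖w₁ z‖ with hB
    have hB0 : 0 ≤ B := norm_nonneg _
    have hA0 : 0 ≤ A := by
      have := norm_nonneg (w z)
      rw [hA] at this
      exact nonneg_of_mul_nonneg_left this hz0
    have h1 : inner ℝ (w z) (w₁ z) ≤ A * z * B := hA ▸ real_inner_le_norm _ _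
    have h2 : z * inner ℝ (w₁ z) (w₂ z) ≤ - (7 / 2) * B ^ 2 + z * K * B ^ 2 + K * B * (A * z) := by
      have e1 : z • w₂ z = (-(7 / 2) : ℝ) • w₁ z + z • (P z * w₁ z) + Q z * w z := by
        simp only [Complex.real_smul]
        push_cast
        linear_combination hode z hz
      have e2 : inner ℝ (w₁ z) (P z * w₁ z) ≤ K * B ^ 2 := by
        refine (real_inner_le_norm _ _).trans ?_
        rw [norm_mul, ← hB]
        nlinarith [mul_le_mul_of_nonneg_right (hP z hz) (sq_nonneg B)]
      have e3 : inner ℝ (w₁ z) (Q z * w z) ≤ K * B * (A * z) := by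
        refine (real_inner_le_norm _ _).trans ?_
        rw [norm_mul, ← hB, hA]
        have : 0 ≤ A * z := by positivity
        calc B * (‖Q z‖ * (A * z)) ≤ B * (K * (A * z)) := by gcongr; exact hQ z hz
          _ = _ := by ring
      rw [← real_inner_smul_right, e1, inner_add_right, inner_add_right, real_inner_smul_right,
        real_inner_smul_right, real_inner_self_eq_norm_sq, ← hB]
      have := mul_le_mul_of_nonneg_left e2 hz0.le
      linarith
    have h3 : (2 * inner ℝ (w z) (w₁ z) * z - ‖w z‖ ^ 2 * 1) / z ^ 2 ≤ 2 * A * B - A ^ 2 := by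
      rw [div_le_iff₀ (by positivity), hA]
      nlinarith [mul_le_mul_of_nonneg_right h1 hz0.le]
    have h4 : E z = z * A ^ 2 + z * B ^ 2 := by
      simp only [hE, hA, ← hB]; field_simp
    have h5 : 0 ≤ K * z * (A - B) ^ 2 := by positivity
    have h6 : 0 ≤ K * z * A ^ 2 := by positivity
    have h7 : 0 ≤ K * z * B ^ 2 := by positivity
    rw [h4]
    simp only [hE', ← hB]
    nlinarith [sq_nonneg (A - B), sq_nonneg B]
  set F : ℝ → ℝ := fun z ↦ E z * Real.exp (-(3 * K * z)) with hF
  have hFd : ∀ z ∈ Ioo 0 b, HasDerivAt F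
      (E' z * Real.exp (-(3 * K * z)) + E z * (Real.exp (-(3 * K * z)) * -(3 * K * 1))) z :=
    fun z hz ↦ (hEd z hz).mul (((hasDerivAt_id z).const_mul (3 * K)).neg.exp)
  have hanti : AntitoneOn F (Ioo 0 b) := by
    refine antitoneOn_of_deriv_nonpos (convex_Ioo 0 b)
      (fun z hz ↦ (hFd z hz).continuousAt.continuousWithinAt)
      (fun z hz ↦ (hFd z (interior_subset hz)).differentiableAt.differentiableWithinAt)
      fun z hz ↦ ?_
    have hz' := interior_subset hz
    rw [(hFd z hz').deriv]
    have := mul_le_mul_of_nonneg_right (hE'le z hz') (Real.exp_pos (-(3 * K * z))).le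
    linarith
  have hE0 : ∀ z ∈ Ioo 0 b, 0 ≤ E z := fun z hz ↦ by
    have := hz.1
    simp only [hE]; positivity
  have hFle : ∀ z ∈ Ioo 0 b, F z ≤ 2 * M ^ 2 * z := by
    intro z hz
    have hz0 := hz.1
    have h1 : Real.exp (-(3 * K * z)) ≤ 1 := Real.exp_le_one_iff.2 (by
      have : 0 ≤ 3 * K * z := by positivity
      linarith)
    have h2 : ‖w z‖ ^ 2 / z ≤ M ^ 2 * z := by
      rw [div_le_iff₀ hz0]
      calc ‖w z‖ ^ 2 ≤ (M * z) ^ 2 := by gcongr; exact hwM z hz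
        _ = _ := by ring
    have h3 : z * ‖w₁ z‖ ^ 2 ≤ z * M ^ 2 := by gcongr; exact hM z hz
    calc F z ≤ E z := mul_le_of_le_one_right (hE0 z hz) h1
      _ ≤ _ := by simp only [hE]; linarith
  have hFz : F z₀ ≤ 0 := by
    have hlim : Tendsto (fun y : ℝ ↦ 2 * M ^ 2 * y) (𝓝[>] 0) (𝓝 (2 * M ^ 2 * 0)) :=
      (tendsto_nhdsWithin_of_tendsto_nhds tendsto_id).const_mul _
    rw [mul_zero] at hlim
    refine ge_of_tendsto hlim ?_
    filter_upwards [Ioo_mem_nhdsGT hz₀.1] with y hy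
    have hy' : y ∈ Ioo 0 b := ⟨hy.1, hy.2.trans hz₀.2⟩
    exact (hanti hy' hz₀ hy.2.le).trans (hFle y hy')
  have hEz : E z₀ ≤ 0 := nonpos_of_mul_nonpos_left hFz (Real.exp_pos _)
  have h1 : 0 ≤ z₀ * ‖w₁ z₀‖ ^ 2 := by have := hz₀.1; positivity
  have h2 : ‖w z₀‖ ^ 2 / z₀ ≤ 0 := by simp only [hE] at hEz; linarith
  have h3 : ‖w z₀‖ ^ 2 ≤ 0 := by
    have := (div_le_iff₀ hz₀.1).1 h2
    simpa using this
  exact norm_eq_zero.1 (pow_eq_zero_iff two_ne_zero |>.1 (le_antisymm h3 (sq_nonneg _)))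

end Uniqueness

section HeunSeries

/-- The recurrence for the Taylor coefficients at `0` of a solution of the Heun equation. -/
structure IsHeunSeries (l : ℂ) (a : ℕ → ℂ) : Prop where
  one : 7 * a 1 = (l ^ 2 + 12 * l + 12) / 4 * a 0
  add_two : ∀ n : ℕ, ((n : ℂ) + 2) * (2 * n + 9) * a (n + 2)
    = (3 * ((n : ℂ) + 1) ^ 2 + (8 + 2 * l) * (n + 1) + (l ^ 2 + 12 * l + 12) / 4) * a (n + 1)
      - ((n : ℂ) + 1 + l / 2) * (n + 2 + l / 2) * a n

/-- The Taylor coefficients at `0` of the holomorphic Heun function with value `c` at `0`. -/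
noncomputable def heunCoeff (l c : ℂ) : ℕ → ℂ
  | 0 => c
  | 1 => (l ^ 2 + 12 * l + 12) / 28 * c
  | n + 2 =>
    ((3 * ((n : ℂ) + 1) ^ 2 + (8 + 2 * l) * (n + 1) + (l ^ 2 + 12 * l + 12) / 4)
        * heunCoeff l c (n + 1)
      - ((n : ℂ) + 1 + l / 2) * (n + 2 + l / 2) * heunCoeff l c n) / ((n + 2) * (2 * n + 9))

theorem isHeunSeries_heunCoeff (l c : ℂ) : IsHeunSeries l (heunCoeff l c) where
  one := by simp only [heunCoeff]; ring
  add_two n := by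
    have h1 : (n : ℂ) + 2 ≠ 0 := by exact_mod_cast (n + 1).succ_ne_zero
    have h2 : 2 * (n : ℂ) + 9 ≠ 0 := by exact_mod_cast (2 * n + 8).succ_ne_zero
    rw [heunCoeff, mul_div_cancel₀ _ (mul_ne_zero h1 h2)]

theorem hasSum_mul_of_shift {u v : ℕ → ℂ} {z s : ℂ} (h : HasSum (fun n ↦ u n * z ^ n) s)
    (h0 : v 0 = 0) (hv : ∀ n, v (n + 1) = u n) : HasSum (fun n ↦ v n * z ^ n) (z * s) := by
  have hshift : HasSum (fun n ↦ v (n + 1) * z ^ (n + 1)) (z * s) := by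
    have : (fun n ↦ v (n + 1) * z ^ (n + 1)) = fun n ↦ z * (u n * z ^ n) := by
      funext n
      rw [hv, pow_succ]
      ring
    rw [this]
    exact h.mul_left z
  simpa [h0] using (hasSum_nat_add_iff (f := fun n ↦ v n * z ^ n) 1).1 hshift

theorem IsHeunSeries.ode {l : ℂ} {a : ℕ → ℂ} (ha : IsHeunSeries l a) {z s₀ s₁ s₂ : ℂ}
    (h₀ : HasSum (fun n ↦ a n * z ^ n) s₀)
    (h₁ : HasSum (fun n : ℕ ↦ ((n : ℂ) + 1) * a (n + 1) * z ^ n) s₁)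
    (h₂ : HasSum (fun n : ℕ ↦ ((n : ℂ) + 1) * (((n + 1 : ℕ) + 1) * a (n + 1 + 1)) * z ^ n) s₂) :
    z * (z - 1) * (z - 2) * s₂ + ((4 + l) * z ^ 2 - (11 + 2 * l) * z + 7) * s₁
      + ((l + 4) * (l + 2) * z - (l ^ 2 + 12 * l + 12)) / 4 * s₀ = 0 := by
  have hz₁ : HasSum (fun n : ℕ ↦ (n : ℂ) * a n * z ^ n) (z * s₁) :=
    hasSum_mul_of_shift h₁ (by simp) fun n ↦ by push_cast; ring
  have hz₂ : HasSum (fun n : ℕ ↦ (n : ℂ) * (n + 1) * a (n + 1) * z ^ n) (z * s₂) :=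
    hasSum_mul_of_shift h₂ (by simp) fun n ↦ by push_cast; ring
  have hzz₂ : HasSum (fun n : ℕ ↦ (n : ℂ) * (n - 1) * a n * z ^ n) (z * (z * s₂)) :=
    hasSum_mul_of_shift hz₂ (by simp) fun n ↦ by push_cast; ring
  have hup := ((hzz₂.add (hz₁.mul_left (4 + l))).add
    (h₀.mul_left ((l + 4) * (l + 2) / 4))).mul_left (-z)
  have hlow := ((hz₂.mul_left 2).add (h₁.mul_left 7)).sub
    (((hzz₂.mul_left 3).add (hz₁.mul_left (11 + 2 * l))).add
      (h₀.mul_left ((l ^ 2 + 12 * l + 12) / 4)))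
  have hshift := (hasSum_nat_add_iff' 1).2 hlow
  have hterm : ∀ n : ℕ, -z * ((n : ℂ) * (n - 1) * a n * z ^ n + (4 + l) * (n * a n * z ^ n)
      + (l + 4) * (l + 2) / 4 * (a n * z ^ n))
      = 2 * (((n + 1 : ℕ) : ℂ) * ((n + 1 : ℕ) + 1) * a (n + 1 + 1) * z ^ (n + 1))
        + 7 * ((((n + 1 : ℕ) : ℂ) + 1) * a (n + 1 + 1) * z ^ (n + 1))
        - (3 * (((n + 1 : ℕ) : ℂ) * ((n + 1 : ℕ) - 1) * a (n + 1) * z ^ (n + 1))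
          + (11 + 2 * l) * (((n + 1 : ℕ) : ℂ) * a (n + 1) * z ^ (n + 1))
          + (l ^ 2 + 12 * l + 12) / 4 * (a (n + 1) * z ^ (n + 1))) := by
    intro n
    push_cast
    linear_combination (-z ^ (n + 1)) * ha.add_two n
  simp only [hterm] at hup
  have heq := hshift.unique hup
  have h7 := ha.one
  simp at heq
  linear_combination heq + h7

/-- The coefficients of a Heun series normalized by those of the second primitive of
`(1 - z) ^ (-(l + 1))`. -/
noncomputable def heunRatio (l : ℂ) (a : ℕ → ℂ) (n : ℕ) : ℂ :=
  (n + 1) * (n + 2) * a (n + 2) / negBinomCoeff (l + 1) n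

theorem heunRatio_mul {l : ℂ} (hl : 0 ≤ l.re) (a : ℕ → ℂ) (n : ℕ) :
    heunRatio l a n * negBinomCoeff (l + 1) n = (n + 1) * (n + 2) * a (n + 2) :=
  div_mul_cancel₀ _ (negBinomCoeff_ne_zero (by simp; linarith) n)

theorem negBinomCoeff_succ (s : ℂ) (n : ℕ) :
    ((n : ℂ) + 1) * negBinomCoeff s (n + 1) = (s + n) * negBinomCoeff s n := by
  have h : (n : ℂ) + 1 ≠ 0 := by exact_mod_cast n.succ_ne_zero
  rw [negBinomCoeff, Finset.prod_range_succ, ← negBinomCoeff]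
  field_simp

theorem IsHeunSeries.heunRatio_add_two {l : ℂ} (hl : 0 ≤ l.re) {a : ℕ → ℂ}
    (ha : IsHeunSeries l a) (n : ℕ) :
    (2 * (n : ℂ) + 13) * (n + 1 + l) * (n + 2 + l)
        * (heunRatio l a (n + 2) - heunRatio l a (n + 1))
      = (n + 3) * (n + 3 + l / 2) * (n + 4 + l / 2) * (heunRatio l a (n + 1) - heunRatio l a n)
        + ((4 - 3 / 2 * l) * (n + 3) + (l - 2) * (l ^ 2 - 16 * l + 40) / 4)
          * heunRatio l a (n + 1) := by
  have hb : negBinomCoeff (l + 1) n ≠ 0 := negBinomCoeff_ne_zero (by simp; linarith) n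
  have h0 := heunRatio_mul hl a n
  have h1 := heunRatio_mul hl a (n + 1)
  have h2 := heunRatio_mul hl a (n + 2)
  have b1 := negBinomCoeff_succ (l + 1) n
  have b2 := negBinomCoeff_succ (l + 1) (n + 1)
  have hr := ha.add_two (n + 2)
  push_cast at h1 h2 b2 hr
  refine mul_right_cancel₀ hb ?_
  set q0 := heunRatio l a n
  set q1 := heunRatio l a (n + 1)
  set q2 := heunRatio l a (n + 2)
  have e1 : q1 * ((l + 1 + n) * negBinomCoeff (l + 1) n)
      = (n + 1) * (n + 2) * (n + 3) * a (n + 3) := by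
    linear_combination (n + 1 : ℂ) * h1 - q1 * b1
  have e2 : q2 * ((l + 1 + n) * (l + 2 + n) * negBinomCoeff (l + 1) n)
      = (n + 1) * (n + 2) * (n + 3) * (n + 4) * a (n + 4) := by
    linear_combination (n + 1 : ℂ) * (n + 2) * h2 - q2 * (n + 1) * b2 - q2 * (l + 2 + n) * b1
  linear_combination (2 * (n : ℂ) + 13) * e2 - (n + 3 : ℂ) * (n + 3 + l / 2) * (n + 4 + l / 2) * (-h0)
    - (3 * ((n : ℂ) + 3) ^ 2 + (8 + 2 * l) * (n + 3) + (l ^ 2 + 12 * l + 12) / 4) * e1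
    + (n + 1 : ℂ) * (n + 2) * (n + 3) * hr

theorem natCast_le_norm_add {s : ℂ} (hs : 0 ≤ s.re) (n : ℕ) : (n : ℝ) ≤ ‖(n : ℂ) + s‖ := by
  refine le_trans ?_ (Complex.re_le_norm _)
  simpa using hs

theorem IsHeunSeries.exists_contraction {l : ℂ} (hl : 0 ≤ l.re) {a : ℕ → ℂ}
    (ha : IsHeunSeries l a) :
    ∃ α ε : ℕ → ℝ, Tendsto α atTop (𝓝 (1 / 2)) ∧ (∀ n, 0 ≤ ε n) ∧ Summable ε ∧
      ∀ n, ‖heunRatio l a (n + 2) - heunRatio l a (n + 1)‖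
        ≤ α n * ‖heunRatio l a (n + 1) - heunRatio l a n‖ + ε n * ‖heunRatio l a (n + 1)‖ := by
  set U : ℕ → ℂ := fun n ↦ (2 * (n : ℂ) + 13) * (n + 1 + l) * (n + 2 + l)
  set V : ℕ → ℂ := fun n ↦ ((n : ℂ) + 3) * (n + 3 + l / 2) * (n + 4 + l / 2)
  set W : ℕ → ℂ := fun n ↦ (4 - 3 / 2 * l) * ((n : ℂ) + 3) + (l - 2) * (l ^ 2 - 16 * l + 40) / 4
  set κ : ℝ := 3 * ‖4 - 3 / 2 * l‖ + ‖(l - 2) * (l ^ 2 - 16 * l + 40) / 4‖ with hκ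
  have hU : ∀ n : ℕ, ((n : ℝ) + 1) ^ 3 ≤ ‖U n‖ := by
    intro n
    have h1 := natCast_le_norm_add hl (n + 1)
    have h2 := natCast_le_norm_add hl (n + 2)
    have h3 : (2 * n + 13 : ℝ) = ‖2 * (n : ℂ) + 13‖ := by
      rw [show 2 * (n : ℂ) + 13 = ((2 * n + 13 : ℝ) : ℂ) by push_cast; rfl, Complex.norm_real,
        Real.norm_of_nonneg (by positivity)]
    push_cast at h1 h2
    simp only [U]
    rw [norm_mul, norm_mul, ← h3]
    calc ((n : ℝ) + 1) ^ 3 = (n + 1) * (n + 1) * (n + 1) := by ring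
      _ ≤ (2 * n + 13) * (n + 1) * (n + 2) := by gcongr <;> linarith
      _ ≤ _ := by gcongr
  have hU0 : ∀ n, 0 < ‖U n‖ := fun n ↦ lt_of_lt_of_le (by positivity) (hU n)
  refine ⟨fun n ↦ ‖V n / U n‖, fun n ↦ κ * (1 / ((n : ℝ) + 1) ^ 2), ?_, fun n ↦ by positivity, ?_,
    fun n ↦ ?_⟩
  · have h1 := tendsto_add_mul_div_add_mul_atTop_nhds (3 : ℂ) 13 1 (d := 2) two_ne_zero
    have h2 := tendsto_add_mul_div_add_mul_atTop_nhds (3 + l / 2) (1 + l) 1 (d := 1) one_ne_zero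
    have h3 := tendsto_add_mul_div_add_mul_atTop_nhds (4 + l / 2) (2 + l) 1 (d := 1) one_ne_zero
    have h := ((h1.mul h2).mul h3).norm
    have hlim : ‖(1 : ℂ) / 2 * (1 / 1) * (1 / 1)‖ = 1 / 2 := by norm_num
    rw [hlim] at h
    refine h.congr fun n ↦ ?_
    rw [div_mul_div_comm, div_mul_div_comm]
    congr 2 <;> simp only [U, V] <;> ring
  · have := (summable_nat_add_iff 1).2 (Real.summable_one_div_nat_pow.2 one_lt_two)
    push_cast at this
    exact this.mul_left κ
  · have hn1 : ‖(n : ℂ) + 3‖ = n + 3 := by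
      rw [show (n : ℂ) + 3 = ((n + 3 : ℝ) : ℂ) by push_cast; rfl, Complex.norm_real,
        Real.norm_of_nonneg (by positivity)]
    have hW : ‖W n‖ ≤ κ * (n + 1) := by
      refine (norm_add_le _ _).trans ?_
      rw [norm_mul, hn1, hκ]
      have h1 := norm_nonneg (4 - 3 / 2 * l)
      have h2 := norm_nonneg ((l - 2) * (l ^ 2 - 16 * l + 40) / 4)
      have h3 : (0 : ℝ) ≤ n := n.cast_nonneg
      nlinarith [mul_nonneg h1 h3, mul_nonneg h2 h3]
    have hWU : ‖W n / U n‖ ≤ κ * (1 / ((n : ℝ) + 1) ^ 2) := by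
      rw [norm_div, div_le_iff₀ (hU0 n)]
      calc ‖W n‖ ≤ κ * (n + 1) := hW
        _ = κ * (1 / ((n : ℝ) + 1) ^ 2) * (n + 1) ^ 3 := by field_simp
        _ ≤ _ := by gcongr; exact hU n
    have hrec := ha.heunRatio_add_two hl n
    have hU' : U n ≠ 0 := norm_pos_iff.1 (hU0 n)
    have : heunRatio l a (n + 2) - heunRatio l a (n + 1)
        = V n / U n * (heunRatio l a (n + 1) - heunRatio l a n)
          + W n / U n * heunRatio l a (n + 1) := by
      rw [div_mul_eq_mul_div, div_mul_eq_mul_div, ← add_div, eq_div_iff hU']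
      linear_combination hrec
    rw [this]
    refine (norm_add_le _ _).trans ?_
    rw [norm_mul, norm_mul]
    gcongr

theorem IsHeunSeries.exists_tendsto_heunRatio {l : ℂ} (hl : 0 ≤ l.re) {a : ℕ → ℂ}
    (ha : IsHeunSeries l a) :
    Summable (fun n ↦ ‖heunRatio l a (n + 1) - heunRatio l a n‖) ∧
      ∃ c, Tendsto (heunRatio l a) atTop (𝓝 c) := by
  obtain ⟨α, ε, hα, hε0, hε, h⟩ := ha.exists_contraction hl
  obtain ⟨N, hN⟩ := eventually_atTop.1 (hα.eventually_le_const (show (1 : ℝ) / 2 < 3 / 4 by norm_num))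
  have hs := summable_norm_increment (q := fun n ↦ heunRatio l a (n + N)) (β := 3 / 4)
    (ε := fun n ↦ ε (n + N)) (by norm_num) (fun n ↦ hε0 _)
    ((summable_nat_add_iff N).2 hε) (fun n ↦ by
      have h1 := h (n + N)
      have h2 := mul_le_mul_of_nonneg_right (hN (n + N) (by omega))
        (norm_nonneg (heunRatio l a (n + N + 1) - heunRatio l a (n + N)))
      rw [show n + 2 + N = n + N + 2 by ring, show n + 1 + N = n + N + 1 by ring]
      linarith)
  have hs' : Summable fun n ↦ ‖heunRatio l a (n + 1) - heunRatio l a n‖ := by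
    refine (summable_nat_add_iff N).1 (hs.congr fun n ↦ ?_)
    rw [show n + 1 + N = n + N + 1 by ring]
  refine ⟨hs', cauchySeq_tendsto_of_complete (cauchySeq_of_summable_dist (hs'.congr fun n ↦ ?_))⟩
  rw [dist_comm, dist_eq_norm]

theorem summable_of_heunRatio_le {l : ℂ} (hl : 0 ≤ l.re) {a : ℕ → ℂ} {N : ℕ} {C ρ r : ℝ}
    (hρ : 0 < ρ) (hC : ∀ n, ‖heunRatio l a (n + N)‖ ≤ C * ρ ^ n) (hr : 0 ≤ r) (hρr : ρ * r < 1) :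
    Summable fun n ↦ ‖a n‖ * r ^ n := by
  have hs : 0 < (l + 1).re := by simp; linarith
  obtain ⟨K, hK0, hK⟩ := exists_norm_negBinomCoeff_le hs
  have hβ := (summable_nat_add_iff N).2
    (hasSum_norm_negBinomCoeff hs (mul_nonneg hρ.le hr) hρr).summable
  rw [← summable_nat_add_iff (N + 2)]
  refine Summable.of_nonneg_of_le (fun n ↦ by positivity) (fun n ↦ ?_)
    (hβ.mul_left (C * K * r ^ 2 / ρ ^ N))
  have h1 := heunRatio_mul hl a (n + N)
  have h2 : ‖a (n + N + 2)‖ ≤ C * ρ ^ n * (K * ‖negBinomCoeff ((l + 1).re : ℂ) (n + N)‖) := by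
    calc ‖a (n + N + 2)‖
        ≤ ‖(((n + N : ℕ) : ℂ) + 1) * (((n + N : ℕ) : ℂ) + 2)‖ * ‖a (n + N + 2)‖ := by
          refine le_mul_of_one_le_left (norm_nonneg _) ?_
          rw [show (((n + N : ℕ) : ℂ) + 1) * (((n + N : ℕ) : ℂ) + 2)
            = (((((n + N : ℕ) : ℝ) + 1) * (((n + N : ℕ) : ℝ) + 2) : ℝ) : ℂ) by push_cast; rfl,
            Complex.norm_real, Real.norm_of_nonneg (by positivity)]
          nlinarith [(n + N).cast_nonneg (α := ℝ)]
      _ = ‖heunRatio l a (n + N)‖ * ‖negBinomCoeff (l + 1) (n + N)‖ := by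
          rw [← norm_mul, ← norm_mul, h1]
      _ ≤ _ := by
          have hC0 := (norm_nonneg _).trans (hC n)
          gcongr
          · exact hC n
          · exact hK _
  rw [show n + (N + 2) = n + N + 2 by ring]
  calc ‖a (n + N + 2)‖ * r ^ (n + N + 2)
      ≤ C * ρ ^ n * (K * ‖negBinomCoeff ((l + 1).re : ℂ) (n + N)‖) * r ^ (n + N + 2) := by
        gcongr
    _ = _ := by
        rw [mul_pow]; field_simp; ring

theorem IsHeunSeries.summable_of_lt_one {l : ℂ} (hl : 0 ≤ l.re) {a : ℕ → ℂ}
    (ha : IsHeunSeries l a) (r : ℝ) (hr0 : 0 ≤ r) (hr : r < 1) :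
    Summable fun n ↦ ‖a n‖ * r ^ n := by
  obtain ⟨-, c, hc⟩ := ha.exists_tendsto_heunRatio hl
  obtain ⟨C, hC⟩ := hc.norm.bddAbove_range
  exact summable_of_heunRatio_le hl (N := 0) (C := C) one_pos
    (fun n ↦ by simpa using hC ⟨n, rfl⟩) hr0 (by simpa using hr)

theorem IsHeunSeries.summable_of_lt_two {l : ℂ} (hl : 0 ≤ l.re) {a : ℕ → ℂ}
    (ha : IsHeunSeries l a) (h0 : Tendsto (heunRatio l a) atTop (𝓝 0)) (r : ℝ) (hr0 : 0 ≤ r)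
    (hr : r < 2) : Summable fun n ↦ ‖a n‖ * r ^ n := by
  obtain ⟨α, ε, hα, hε0, hε, h⟩ := ha.exists_contraction hl
  obtain ⟨ρ, hρ, hρr⟩ : ∃ ρ : ℝ, 1 / 2 < ρ ∧ ρ * r < 1 := by
    refine ⟨2 / (r + 2), ?_, ?_⟩
    · rw [div_lt_div_iff₀ (by norm_num) (by linarith)]; linarith
    · rw [div_mul_eq_mul_div, div_lt_one (by linarith)]; linarith
  obtain ⟨β, hβ, hβρ⟩ := exists_between hρ
  have hρ0 : 0 < ρ := by linarith
  have htail : (0 : ℝ) < 1 - β / ρ := by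
    rw [sub_pos, div_lt_one hρ0]; exact hβρ
  obtain ⟨N, hN, hN'⟩ := ((eventually_forall_ge_atTop.2 (hα.eventually_le_const hβ)).and
    ((tendsto_sum_nat_add ε).eventually_lt_const htail)).exists
  have hs := (summable_nat_add_iff N).2 (ha.exists_tendsto_heunRatio hl).1
  have hβ0 : 0 < β / ρ := by
    have : 0 < β := by linarith
    positivity
  obtain ⟨C, hC⟩ := norm_le_geometric_of_tendsto_zero (q := fun n ↦ heunRatio l a (n + N))
    (β := β) (ρ := ρ) (ε := fun n ↦ ε (n + N)) (by linarith) (fun n ↦ hε0 _)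
    ((summable_nat_add_iff N).2 hε) (by linarith)
    (by
      calc β = β / ρ * ρ := by field_simp
        _ ≤ _ := by gcongr; linarith)
    (fun n ↦ by
      have h1 := h (n + N)
      have h2 := mul_le_mul_of_nonneg_right (hN (n + N) (by omega))
        (norm_nonneg (heunRatio l a (n + N + 1) - heunRatio l a (n + N)))
      rw [show n + 2 + N = n + N + 2 by ring, show n + 1 + N = n + N + 1 by ring]
      linarith)
    (hs.congr fun n ↦ by rw [show n + 1 + N = n + N + 1 by ring])
    ((tendsto_add_atTop_iff_nat N).2 h0)
  exact summable_of_heunRatio_le hl hρ0 hC hr0 hρr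

end HeunSeries

section Main

theorem HeunEq.mul_denominators {l : ℂ} {g : ℝ → ℂ} {z : ℝ} (hz : z ∈ Ioo (0 : ℝ) 1)
    (h : HeunEq l g z) :
    (z : ℂ) * (z - 1) * (z - 2) * deriv (deriv g) z
      + ((4 + l) * (z : ℂ) ^ 2 - (11 + 2 * l) * z + 7) * deriv g z
      + ((l + 4) * (l + 2) * z - (l ^ 2 + 12 * l + 12)) / 4 * g z = 0 := by
  have h0 : (z : ℂ) ≠ 0 := by exact_mod_cast hz.1.ne'
  have h1 : (z : ℂ) - 1 ≠ 0 := by exact_mod_cast (sub_neg.2 hz.2).ne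
  have h2 : (z : ℂ) - 2 ≠ 0 := by exact_mod_cast (sub_neg.2 (hz.2.trans one_lt_two)).ne
  rw [HeunEq] at h
  field_simp at h
  linear_combination h / 8

theorem eqOn_tsum_of_heun {l : ℂ} (hl : 0 ≤ l.re) {g g₁ g₂ : ℝ → ℂ} {M : ℝ}
    {a : ℕ → ℂ} (ha : IsHeunSeries l a) (ha0 : a 0 = g 0)
    (hg : ∀ z ∈ Ioo (0 : ℝ) 1, HasDerivAt g (g₁ z) z)
    (hg₁ : ∀ z ∈ Ioo (0 : ℝ) 1, HasDerivAt g₁ (g₂ z) z)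
    (hode : ∀ z ∈ Ioo (0 : ℝ) 1, (z : ℂ) * (z - 1) * (z - 2) * g₂ z
      + ((4 + l) * (z : ℂ) ^ 2 - (11 + 2 * l) * z + 7) * g₁ z
      + ((l + 4) * (l + 2) * z - (l ^ 2 + 12 * l + 12)) / 4 * g z = 0)
    (hM : ∀ z ∈ Ioo (0 : ℝ) 1, ‖g₁ z‖ ≤ M) (hcont : Tendsto g (𝓝[>] 0) (𝓝 (g 0))) :
    ∀ z ∈ Ioo (0 : ℝ) 1, g z = ∑' n, a n * (z : ℂ) ^ n := by
  intro z₀ hz₀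
  obtain ⟨b, hzb, hb1⟩ := exists_between hz₀.2
  have hb0 : 0 < b := hz₀.1.trans hzb
  have hs := ha.summable_of_lt_one hl
  have hs₁ := summable_deriv_coeff hs
  have hs₂ := summable_deriv_coeff hs₁
  have hnorm : ∀ z ∈ Icc (0 : ℝ) b, ‖(z : ℂ)‖ < 1 := fun z hz ↦ by
    rw [Complex.norm_real, Real.norm_of_nonneg hz.1]; exact hz.2.trans_lt hb1
  set F : ℝ → ℂ := fun z ↦ ∑' n, a n * (z : ℂ) ^ n with hF
  set F₁ : ℝ → ℂ := fun z ↦ ∑' n : ℕ, ((n : ℂ) + 1) * a (n + 1) * (z : ℂ) ^ n with hF₁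
  set F₂ : ℝ → ℂ := fun z ↦
    ∑' n : ℕ, ((n : ℂ) + 1) * (((n + 1 : ℕ) + 1) * a (n + 1 + 1)) * (z : ℂ) ^ n with hF₂
  have hFd : ∀ z ∈ Icc (0 : ℝ) b, HasDerivAt F (F₁ z) z := fun z hz ↦
    (hasDerivAt_tsum_pow hs (hnorm z hz)).comp_ofReal
  have hFd₁ : ∀ z ∈ Icc (0 : ℝ) b, HasDerivAt F₁ (F₂ z) z := fun z hz ↦
    (hasDerivAt_tsum_pow hs₁ (hnorm z hz)).comp_ofReal
  have hFode : ∀ z ∈ Icc (0 : ℝ) b, _ := fun z hz ↦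
    ha.ode (summable_mul_pow hs (hnorm z hz)).hasSum (summable_mul_pow hs₁ (hnorm z hz)).hasSum
      (summable_mul_pow hs₂ (hnorm z hz)).hasSum
  have hz1 : ∀ z ∈ Icc (0 : ℝ) b, 1 - (z : ℂ) ≠ 0 := fun z hz ↦ by
    exact_mod_cast (sub_pos.2 (hz.2.trans_lt hb1)).ne'
  have hz2 : ∀ z ∈ Icc (0 : ℝ) b, 2 - (z : ℂ) ≠ 0 := fun z hz ↦ by
    exact_mod_cast (sub_pos.2 ((hz.2.trans_lt hb1).trans one_lt_two)).ne'
  set P : ℝ → ℂ := fun z ↦ l / (1 - z) + 1 / (2 * (2 - z)) with hP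
  set Q : ℝ → ℂ := fun z ↦
    -((l + 4) * (l + 2) * z - (l ^ 2 + 12 * l + 12)) / (4 * ((1 - z) * (2 - z))) with hQ
  have hPc : ContinuousOn P (Icc 0 b) := by
    refine ContinuousOn.add (ContinuousOn.div (by fun_prop) (by fun_prop) hz1)
      (ContinuousOn.div (by fun_prop) (by fun_prop) fun z hz ↦ ?_)
    exact mul_ne_zero two_ne_zero (hz2 z hz)
  have hQc : ContinuousOn Q (Icc 0 b) := by
    refine ContinuousOn.div (by fun_prop) (by fun_prop) fun z hz ↦ ?_
    exact mul_ne_zero (by norm_num) (mul_ne_zero (hz1 z hz) (hz2 z hz))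
  obtain ⟨KP, hKP⟩ := isCompact_Icc.exists_bound_of_continuousOn hPc
  obtain ⟨KQ, hKQ⟩ := isCompact_Icc.exists_bound_of_continuousOn hQc
  obtain ⟨KF, hKF⟩ := isCompact_Icc.exists_bound_of_continuousOn
    (fun z hz ↦ (hFd₁ z hz).continuousAt.continuousWithinAt : ContinuousOn F₁ (Icc 0 b))
  have hI : ∀ z ∈ Ioo (0 : ℝ) b, z ∈ Ioo (0 : ℝ) 1 := fun z hz ↦ ⟨hz.1, hz.2.trans hb1⟩
  have hFlim : Tendsto F (𝓝[>] 0) (𝓝 (g 0)) := by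
    have h0 := (hFd 0 ⟨le_rfl, hb0.le⟩).continuousAt.tendsto
    have hF0 : F 0 = g 0 := by
      rw [← ha0, hF]
      simp only [Complex.ofReal_zero]
      rw [tsum_eq_single 0 fun n hn ↦ by simp [hn]]
      simp
    rw [hF0] at h0
    exact h0.mono_left nhdsWithin_le_nhds
  have key := eq_zero_of_singular_ode (w := fun z ↦ g z - F z) (w₁ := fun z ↦ g₁ z - F₁ z)
    (w₂ := fun z ↦ g₂ z - F₂ z) (P := P) (Q := Q) (b := b) (K := max KP KQ) (M := M + KF)
    (fun z hz ↦ (hg z (hI z hz)).sub (hFd z (Ioo_subset_Icc_self hz)))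
    (fun z hz ↦ (hg₁ z (hI z hz)).sub (hFd₁ z (Ioo_subset_Icc_self hz)))
    (fun z hz ↦ by
      have e1 := hode z (hI z hz)
      have e2 := hFode z (Ioo_subset_Icc_self hz)
      have n1 := hz1 z (Ioo_subset_Icc_self hz)
      have n2 := hz2 z (Ioo_subset_Icc_self hz)
      simp only [hP, hQ]
      field_simp
      linear_combination 8 * e1 - 8 * e2)
    (fun z hz ↦ (hKP z (Ioo_subset_Icc_self hz)).trans (le_max_left _ _))
    (fun z hz ↦ (hKQ z (Ioo_subset_Icc_self hz)).trans (le_max_right _ _))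
    (fun z hz ↦ (norm_sub_le _ _).trans
      (add_le_add (hM z (hI z hz)) (hKF z (Ioo_subset_Icc_self hz))))
    (by simpa using hcont.sub hFlim)
  exact sub_eq_zero.1 (key z₀ ⟨hz₀.1, hzb⟩)

end Main

/-- A solution of the Heun equation that is smooth on `[0,1]` extends to a
holomorphic function on the disc of radius `2`. -/
theorem smooth_heun_solution_extends_holomorphically (l : ℂ) (hl : 0 ≤ l.re)
    (g : ℝ → ℂ) (hg : ContDiffOn ℝ (⊤ : ℕ∞) g (Icc 0 1))
    (heq : ∀ z ∈ Ioo (0 : ℝ) 1, HeunEq l g z) :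
    ∃ G : ℂ → ℂ, DifferentiableOn ℂ G (Metric.ball (0 : ℂ) 2) ∧
      ∀ x ∈ Ico (0 : ℝ) 1, G (x : ℂ) = g x := by
  have hI : UniqueDiffOn ℝ (Icc (0 : ℝ) 1) := uniqueDiffOn_Icc one_pos
  have hnhds : ∀ z ∈ Ioo (0 : ℝ) 1, Icc (0 : ℝ) 1 ∈ 𝓝 z := fun z hz ↦ Icc_mem_nhds hz.1 hz.2
  set g₁ := derivWithin g (Icc 0 1) with hg₁
  set g₂ := derivWithin g₁ (Icc 0 1) with hg₂
  have hc₁ : ContDiffOn ℝ (⊤ : ℕ∞) g₁ (Icc 0 1) := hg.derivWithin hI (by simp)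
  have hc₂ : ContDiffOn ℝ (⊤ : ℕ∞) g₂ (Icc 0 1) := hc₁.derivWithin hI (by simp)
  have hd : ∀ z ∈ Ioo (0 : ℝ) 1, HasDerivAt g (g₁ z) z := fun z hz ↦
    ((hg.differentiableOn (by simp)) z (Ioo_subset_Icc_self hz)).hasDerivWithinAt.hasDerivAt
      (hnhds z hz)
  have hd₁ : ∀ z ∈ Ioo (0 : ℝ) 1, HasDerivAt g₁ (g₂ z) z := fun z hz ↦
    ((hc₁.differentiableOn (by simp)) z (Ioo_subset_Icc_self hz)).hasDerivWithinAt.hasDerivAt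
      (hnhds z hz)
  obtain ⟨M₁, hM₁⟩ := isCompact_Icc.exists_bound_of_continuousOn hc₁.continuousOn
  obtain ⟨M₂, hM₂⟩ := isCompact_Icc.exists_bound_of_continuousOn hc₂.continuousOn
  have hode : ∀ z ∈ Ioo (0 : ℝ) 1, (z : ℂ) * (z - 1) * (z - 2) * g₂ z
      + ((4 + l) * (z : ℂ) ^ 2 - (11 + 2 * l) * z + 7) * g₁ z
      + ((l + 4) * (l + 2) * z - (l ^ 2 + 12 * l + 12)) / 4 * g z = 0 := by
    intro z hz
    have h1 : deriv g =ᶠ[𝓝 z] g₁ := by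
      filter_upwards [isOpen_Ioo.mem_nhds hz] with y hy using (hd y hy).deriv
    have := (heq z hz).mul_denominators hz
    rwa [h1.deriv_eq, h1.eq_of_nhds, (hd₁ z hz).deriv] at this
  have hcont : Tendsto g (𝓝[>] 0) (𝓝 (g 0)) :=
    (hg.continuousOn 0 (left_mem_Icc.2 zero_le_one)).tendsto.mono_left
      (nhdsWithin_le_of_mem (Icc_mem_nhdsGT one_pos))
  set a := heunCoeff l (g 0) with ha_def
  have ha : IsHeunSeries l a := isHeunSeries_heunCoeff l (g 0)
  have ha0 : a 0 = g 0 := by rw [ha_def, heunCoeff]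
  have hgF : ∀ z ∈ Ioo (0 : ℝ) 1, g z = ∑' n, a n * (z : ℂ) ^ n :=
    eqOn_tsum_of_heun hl ha ha0 hd hd₁ hode
      (fun z hz ↦ hM₁ z (Ioo_subset_Icc_self hz)) hcont
  have hs := ha.summable_of_lt_one hl
  have hs₁ := summable_deriv_coeff hs
  have hnorm : ∀ z ∈ Ioo (0 : ℝ) 1, ‖(z : ℂ)‖ < 1 := fun z hz ↦ by
    rw [Complex.norm_real, Real.norm_of_nonneg hz.1.le]; exact hz.2
  have hgF₁ : ∀ z ∈ Ioo (0 : ℝ) 1,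
      g₁ z = ∑' n : ℕ, ((n : ℂ) + 1) * a (n + 1) * (z : ℂ) ^ n := by
    intro z hz
    refine (hd z hz).unique
      ((hasDerivAt_tsum_pow hs (hnorm z hz)).comp_ofReal.congr_of_eventuallyEq ?_)
    filter_upwards [isOpen_Ioo.mem_nhds hz] with y hy using hgF y hy
  have hgF₂ : ∀ z ∈ Ioo (0 : ℝ) 1,
      g₂ z = ∑' n : ℕ, heunRatio l a n * negBinomCoeff (l + 1) n * (z : ℂ) ^ n := by
    intro z hz
    have h1 := (hd₁ z hz).unique
      ((hasDerivAt_tsum_pow hs₁ (hnorm z hz)).comp_ofReal.congr_of_eventuallyEq (by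
        filter_upwards [isOpen_Ioo.mem_nhds hz] with y hy using hgF₁ y hy))
    rw [h1]
    refine tsum_congr fun n ↦ ?_
    rw [heunRatio_mul hl]
    push_cast
    ring
  obtain ⟨-, c, hc⟩ := ha.exists_tendsto_heunRatio hl
  have hc0 : c = 0 := eq_zero_of_bounded_of_tendsto (s := l + 1) (by simp; linarith) hc
    (M := M₂) fun x hx ↦ by
      rw [← hgF₂ x hx]
      exact hM₂ x (Ioo_subset_Icc_self hx)
  have hs2 := ha.summable_of_lt_two hl (hc0 ▸ hc)
  refine ⟨fun z ↦ ∑' n, a n * z ^ n, fun z hz ↦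
    (hasDerivAt_tsum_pow hs2 (mem_ball_zero_iff.1 hz)).differentiableAt.differentiableWithinAt,
    fun x hx ↦ ?_⟩
  rcases hx.1.eq_or_lt with rfl | hx0
  · rw [← ha0]
    simp only [Complex.ofReal_zero]
    rw [tsum_eq_single 0 fun n hn ↦ by simp [hn]]
    simp
  · exact (hgF x ⟨hx0, hx.2⟩).symm
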